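/- For every network N = (G, d, S, T), the regularized tensor-network capacity equals the min-cut: the real sequence n ↦ (R1(N^⊠n))^(1/n) converges as n → ∞ and its limit is MC(N); that is, R(N) = MC(N). -/

import Mathlib

/-- A finite undirected multigraph without self-loops, together with disjoint
nonempty sets of source and sink vertices, in which every edge has at least
one internal endpoint (an internal vertex is one that is neither a source
nor a sink). Dimension functions on the edges are kept separate. -/
structure NetShape where
  V : Type
  E : Type
  [fintypeV : Fintype V]
  [fintypeE : Fintype E]
  [decEqV : DecidableEq V]
  [decEqE : DecidableEq E]
  /-- the two endpoints of each edge -/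
  ends : E → V × V
  no_loops : ∀ e, (ends e).1 ≠ (ends e).2
  /-- the set of source vertices -/
  S : Finset V
  /-- the set of sink vertices -/
  T : Finset V
  S_nonempty : S.Nonempty
  T_nonempty : T.Nonempty
  ST_disjoint : Disjoint S T
  /-- every edge has at least one internal endpoint -/
  edge_internal : ∀ e, ((ends e).1 ∉ S ∧ (ends e).1 ∉ T) ∨ ((ends e).2 ∉ S ∧ (ends e).2 ∉ T)

attribute [instance] NetShape.fintypeV NetShape.fintypeE NetShape.decEqV NetShape.decEqE

namespace NetShape

variable (G : NetShape)

/-- A vertex is internal if it is neither a source nor a sink. -/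
def Internal (v : G.V) : Prop := v ∉ G.S ∧ v ∉ G.T

instance : DecidablePred G.Internal := fun _ => instDecidableAnd

/-- `e` is incident to `v` if `v` is one of its endpoints. -/
def Incident (v : G.V) (e : G.E) : Prop := (G.ends e).1 = v ∨ (G.ends e).2 = v

instance (v : G.V) : DecidablePred (G.Incident v) := fun _ => instDecidableOr

/-- A source edge: one of its endpoints is a source. -/
def IsSourceEdge (e : G.E) : Prop := (G.ends e).1 ∈ G.S ∨ (G.ends e).2 ∈ G.S

/-- A sink edge: one of its endpoints is a sink. -/
def IsSinkEdge (e : G.E) : Prop := (G.ends e).1 ∈ G.T ∨ (G.ends e).2 ∈ G.T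

/-- An internal edge: both endpoints are internal, i.e. it is neither a source
edge nor a sink edge. -/
def IsInternalEdge (e : G.E) : Prop := ¬ G.IsSourceEdge e ∧ ¬ G.IsSinkEdge e

instance : DecidablePred G.IsSourceEdge := fun _ => instDecidableOr
instance : DecidablePred G.IsSinkEdge := fun _ => instDecidableOr
instance : DecidablePred G.IsInternalEdge := fun _ => instDecidableAnd

/-- A tensor assignment for the dimension function `d`: each internal vertex
`u` carries a tensor with one index of size `d e` for each edge `e` incident
to `u`. -/
def TensorAssignment (d : G.E → ℕ) : Type :=
  ∀ u : {v : G.V // G.Internal v},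
    ((e : {e : G.E // G.Incident u.1 e}) → Fin (d e.1)) → ℂ

/-- Combine index assignments on source, sink and internal edges into an index
assignment on all edges. -/
def fullIndex (d : G.E → ℕ)
    (a : (e : {e : G.E // G.IsSourceEdge e}) → Fin (d e.1))
    (b : (e : {e : G.E // G.IsSinkEdge e}) → Fin (d e.1))
    (c : (e : {e : G.E // G.IsInternalEdge e}) → Fin (d e.1))
    (e : G.E) : Fin (d e) :=
  if h : G.IsSourceEdge e then a ⟨e, h⟩
  else if h' : G.IsSinkEdge e then b ⟨e, h'⟩
  else c ⟨e, ⟨h, h'⟩⟩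

/-- The contraction of the tensor network: the matrix `β_𝒯`, with rows indexed
by the indices of the sink edges and columns by the indices of the source
edges, obtained by summing over all indices of the internal edges the product
over internal vertices of the corresponding tensor entries. -/
noncomputable def contraction (d : G.E → ℕ) (𝒯 : G.TensorAssignment d) :
    Matrix ((e : {e : G.E // G.IsSinkEdge e}) → Fin (d e.1))
           ((e : {e : G.E // G.IsSourceEdge e}) → Fin (d e.1)) ℂ :=
  fun b a =>
    ∑ c : (e : {e : G.E // G.IsInternalEdge e}) → Fin (d e.1),
      ∏ u : {v : G.V // G.Internal v},
        𝒯 u (fun e => G.fullIndex d a b c e.1)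

/-- The one-shot tensor-network capacity: the maximal rank of the contraction
over all tensor assignments. -/
noncomputable def R1 (d : G.E → ℕ) : ℕ :=
  sSup { r | ∃ 𝒯 : G.TensorAssignment d, (G.contraction d 𝒯).rank = r }

/-- A cut, given by the source side `A`: it contains all sources and no sinks
(the sink side is the complement of `A`). -/
def IsCut (A : Finset G.V) : Prop := G.S ⊆ A ∧ ∀ v ∈ G.T, v ∉ A

/-- An edge crosses the cut with source side `A` if exactly one of its
endpoints lies in `A`. -/
def Crosses (A : Finset G.V) (e : G.E) : Prop :=
  ((G.ends e).1 ∈ A ∧ (G.ends e).2 ∉ A) ∨ ((G.ends e).1 ∉ A ∧ (G.ends e).2 ∈ A)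

instance (A : Finset G.V) : DecidablePred (G.Crosses A) := fun _ => instDecidableOr

/-- The value of a cut: the product of the dimensions of the crossing edges. -/
def cutValue (d : G.E → ℕ) (A : Finset G.V) : ℕ :=
  ∏ e ∈ Finset.univ.filter (G.Crosses A), d e

/-- The min-cut: the minimum cut value over all cuts. -/
noncomputable def MC (d : G.E → ℕ) : ℕ :=
  sInf { w | ∃ A : Finset G.V, G.IsCut A ∧ G.cutValue d A = w }

end NetShape

/-- The edge `w` has exactly one endpoint in `A`. -/
def EdgeCrosses {V W : Type*} (ends : W → V × V) (A : Finset V) (w : W) : Prop :=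
  ¬ ((ends w).1 ∈ A ↔ (ends w).2 ∈ A)

open Classical in
/-- Splicing step: labellings on the two sides of a tight cut `A` combine to one labelling. -/
theorem exists_labelling_of_tight_cut {V W : Type*} [Fintype V]
    (ends : W → V × V) (E : Finset W) (S T A : Finset V) (F : ℕ)
    (hSA : S ⊆ A) (hAT : Disjoint A T)
    (htight : (E.filter (EdgeCrosses ends A)).card = F)
    (l₁ l₂ : W → ℕ)
    (h₁ : ∀ i < F, ∀ B, A ⊆ B → Disjoint B T → ∃ w ∈ E, l₁ w = i ∧ EdgeCrosses ends B w)
    (h₂ : ∀ i < F, ∀ B, S ⊆ B → B ⊆ A → ∃ w ∈ E, l₂ w = i ∧ EdgeCrosses ends B w) :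
    ∃ l : W → ℕ, ∀ i < F, ∀ B, S ⊆ B → Disjoint B T →
      ∃ w ∈ E, l w = i ∧ EdgeCrosses ends B w := by
  set D := E.filter (EdgeCrosses ends A) with hD
  have key : ∀ l : W → ℕ, (∀ i < F, ∃ w ∈ E, l w = i ∧ EdgeCrosses ends A w) →
      Set.InjOn l D ∧ ∀ w ∈ D, l w < F := by
    intro l hl
    have hsub : Finset.range F ⊆ D.image l := by
      intro i hi
      obtain ⟨w, hw, hwi, hc⟩ := hl i (Finset.mem_range.1 hi)
      exact Finset.mem_image.2 ⟨w, Finset.mem_filter.2 ⟨hw, hc⟩, hwi⟩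
    have hle : (D.image l).card ≤ (Finset.range F).card := by
      rw [Finset.card_range, ← htight]; exact Finset.card_image_le
    have heq := Finset.eq_of_subset_of_card_le hsub hle
    refine ⟨?_, fun w hw => ?_⟩
    · rw [← Finset.card_image_iff, ← heq, Finset.card_range, htight]
    · have := Finset.mem_image_of_mem l hw
      rw [← heq] at this
      exact Finset.mem_range.1 this
  obtain ⟨inj₁, -⟩ := key l₁ fun i hi => h₁ i hi A subset_rfl hAT
  obtain ⟨inj₂, lt₂⟩ := key l₂ fun i hi => h₂ i hi A hSA subset_rfl
  refine ⟨fun w => if (ends w).1 ∈ A ∧ (ends w).2 ∈ A then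
      (if h : ∃ v ∈ D, l₂ v = l₂ w then l₁ h.choose else F) else l₁ w, ?_⟩
  intro i hi B hSB hBT
  obtain ⟨e, heE, hei, hec⟩ := h₁ i hi A subset_rfl hAT
  have heD : e ∈ D := Finset.mem_filter.2 ⟨heE, hec⟩
  obtain ⟨p, hp, hpi, hpc⟩ := h₁ i hi (A ∪ B) Finset.subset_union_left
    (Finset.disjoint_union_left.2 ⟨hAT, hBT⟩)
  obtain ⟨q, hq, hqi, hqc⟩ := h₂ (l₂ e) (lt₂ e heD) (A ∩ B) (Finset.subset_inter hSA hSB)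
    Finset.inter_subset_left
  have hpe : EdgeCrosses ends A p → p = e := fun h =>
    inj₁ (Finset.mem_coe.2 (Finset.mem_filter.2 ⟨hp, h⟩)) heD (hpi.trans hei.symm)
  have hqe : EdgeCrosses ends A q → q = e := fun h =>
    inj₂ (Finset.mem_coe.2 (Finset.mem_filter.2 ⟨hq, h⟩)) heD hqi
  have hql : ∃ v ∈ D, l₂ v = l₂ q := ⟨e, heD, hqi.symm⟩
  have hqv : l₁ hql.choose = i := by
    rw [inj₂ hql.choose_spec.1 heD (hql.choose_spec.2.trans hqi), hei]
  by_cases ce : EdgeCrosses ends B e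
  · refine ⟨e, heE, (if_neg ?_).trans hei, ce⟩
    rintro ⟨h1, h2⟩
    exact hec (by simp [h1, h2])
  by_cases cp : EdgeCrosses ends B p ∧ ¬ ((ends p).1 ∈ A ∧ (ends p).2 ∈ A)
  · exact ⟨p, hp, (if_neg cp.2).trans hpi, cp.1⟩
  by_cases cq : EdgeCrosses ends B q ∧ ((ends q).1 ∈ A ∧ (ends q).2 ∈ A)
  · exact ⟨q, hq, (if_pos cq.2).trans ((dif_pos hql).trans hqv), cq.1⟩
  exfalso
  clear h₁ h₂ hqv key lt₂ inj₁ inj₂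
  by_cases hpA : EdgeCrosses ends A p
  · rw [hpe hpA] at hpc
    by_cases hqA : EdgeCrosses ends A q
    · rw [hqe hqA] at hqc
      simp only [EdgeCrosses, Finset.mem_union, Finset.mem_inter] at hec hpc hqc ce
      grind
    · simp only [EdgeCrosses, Finset.mem_inter] at hqc cq hqA
      grind
  · simp only [EdgeCrosses, Finset.mem_union] at hpc cp hpA
    grind

open Classical in
/-- **Menger's theorem**, edge version, with edge-disjoint paths replaced by disjoint edge sets
(label classes) meeting every cut. -/
theorem exists_labelling_of_le_cuts {V W : Type*} [Fintype V] (ends : W → V × V) (n : ℕ) :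
    ∀ (E : Finset W) (S T : Finset V) (F : ℕ), Disjoint S T →
      E.card + (S ∪ T)ᶜ.card ≤ n →
      (∀ A, S ⊆ A → Disjoint A T → F ≤ (E.filter (EdgeCrosses ends A)).card) →
      ∃ l : W → ℕ, ∀ i < F, ∀ A, S ⊆ A → Disjoint A T →
        ∃ w ∈ E, l w = i ∧ EdgeCrosses ends A w := by
  induction n with
  | zero =>
    intro E S T F hST hn hcut
    have hE : E = ∅ := Finset.card_eq_zero.1 (by omega)
    have := hcut S subset_rfl hST
    simp only [hE, Finset.filter_empty, Finset.card_empty] at this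
    exact ⟨fun _ => 0, fun i hi => by omega⟩
  | succ n ih =>
    intro E S T F hST hn hcut
    by_cases htight : ∃ A, S ⊆ A ∧ Disjoint A T ∧ A ≠ S ∧ A ≠ Tᶜ ∧
        (E.filter (EdgeCrosses ends A)).card = F
    · obtain ⟨A, hSA, hAT, hneS, hneT, hA⟩ := htight
      have hAT' : A ⊆ Tᶜ := Finset.subset_compl_iff_disjoint_right.2 hAT
      have hTA : T ⊆ Aᶜ := Finset.subset_compl_iff_disjoint_right.2 hAT.symm
      have c₁ : (A ∪ T)ᶜ.card < (S ∪ T)ᶜ.card := by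
        obtain ⟨x, hx, hx'⟩ := Finset.exists_of_ssubset (hSA.ssubset_of_ne hneS.symm)
        apply Finset.card_lt_card
        refine (Finset.ssubset_iff_of_subset ?_).2 ⟨x, ?_, ?_⟩
        · exact Finset.compl_subset_compl.2 (Finset.union_subset_union_left hSA)
        · have := Finset.mem_compl.1 (hAT' hx)
          simp [hx', this]
        · simp [hx]
      have c₂ : (S ∪ Aᶜ)ᶜ.card < (S ∪ T)ᶜ.card := by
        obtain ⟨x, hx, hx'⟩ := Finset.exists_of_ssubset (hAT'.ssubset_of_ne hneT)
        apply Finset.card_lt_card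
        refine (Finset.ssubset_iff_of_subset ?_).2 ⟨x, ?_, ?_⟩
        · exact Finset.compl_subset_compl.2 (Finset.union_subset_union_right hTA)
        · have := Finset.mem_compl.1 hx
          have hxS : x ∉ S := fun h => hx' (hSA h)
          simp [hxS, this]
        · simp [hx']
      obtain ⟨l₁, h₁⟩ := ih E A T F hAT (by omega)
        fun B hB hBT => hcut B (hSA.trans hB) hBT
      obtain ⟨l₂, h₂⟩ := ih E S Aᶜ F (disjoint_compl_right_iff.2 hSA) (by omega)
        fun B hB hBT => hcut B hB (hBT.mono_right hTA)
      exact exists_labelling_of_tight_cut ends E S T A F hSA hAT hA l₁ l₂ h₁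
        fun i hi B hSB hBA => h₂ i hi B hSB (disjoint_compl_right_iff.2 hBA)
    by_cases hfree : ∃ f ∈ E, ∀ A, S ⊆ A → Disjoint A T → EdgeCrosses ends A f →
        (E.filter (EdgeCrosses ends A)).card ≠ F
    · obtain ⟨f, hf, hfA⟩ := hfree
      obtain ⟨l, hl⟩ := ih (E.erase f) S T F hST
        (by have := Finset.card_erase_lt_of_mem hf; omega) (by
          intro A hSA hAT
          have h1 := hcut A hSA hAT
          rw [Finset.filter_erase]
          by_cases hc : EdgeCrosses ends A f
          · have h2 := hfA A hSA hAT hc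
            have := Finset.pred_card_le_card_erase (s := E.filter (EdgeCrosses ends A)) (a := f)
            omega
          · rwa [Finset.erase_eq_of_notMem (by simp [hc])])
      refine ⟨l, fun i hi A hSA hAT => ?_⟩
      obtain ⟨w, hw, h⟩ := hl i hi A hSA hAT
      exact ⟨w, Finset.mem_of_mem_erase hw, h⟩
    obtain _ | F := F
    · exact ⟨fun _ => 0, fun i hi => by omega⟩
    push Not at htight hfree
    have hcross : ∀ f ∈ E, EdgeCrosses ends S f ∨ EdgeCrosses ends Tᶜ f := by
      intro f hf
      obtain ⟨A, hSA, hAT, hc, hA⟩ := hfree f hf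
      by_cases hAS : A = S
      · exact Or.inl (hAS ▸ hc)
      by_cases hAT' : A = Tᶜ
      · exact Or.inr (hAT' ▸ hc)
      exact absurd hA (htight A hSA hAT hAS hAT')
    obtain ⟨D, hDE, hD⟩ : ∃ D ⊆ E, ∀ A, S ⊆ A → Disjoint A T →
        (D.filter (EdgeCrosses ends A)).card = 1 := by
      set A : Finset V := S ∪ Finset.univ.filter fun v => v ∉ T ∧
        ∃ e ∈ E, ((ends e).1 ∈ S ∧ (ends e).2 = v) ∨ ((ends e).2 ∈ S ∧ (ends e).1 = v) with hA
      have hSA : S ⊆ A := Finset.subset_union_left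
      have hAT : Disjoint A T := by
        rw [Finset.disjoint_left]
        intro v hv hvT
        rcases Finset.mem_union.1 hv with h | h
        · exact Finset.disjoint_left.1 hST h hvT
        · exact (Finset.mem_filter.1 h).2.1 hvT
      have hpos : 0 < (E.filter (EdgeCrosses ends A)).card := by
        have := hcut A hSA hAT
        omega
      obtain ⟨w, hw⟩ := Finset.card_pos.1 hpos
      obtain ⟨hwE, hwc⟩ := Finset.mem_filter.1 hw
      obtain ⟨p, q, hpq, hpA, hqA⟩ : ∃ p q, (ends w = (p, q) ∨ ends w = (q, p)) ∧
          p ∈ A ∧ q ∉ A := by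
        by_cases h : (ends w).1 ∈ A
        · exact ⟨_, _, Or.inl rfl, h, fun h' => hwc (by simp [h, h'])⟩
        · exact ⟨_, _, Or.inr rfl, by_contra fun h' => hwc (by simp [h, h']), h⟩
      have hqS : q ∉ S := fun h => hqA (hSA h)
      by_cases hpS : p ∈ S
      · have hqT : q ∈ T := by
          by_contra hqT
          apply hqA
          refine Finset.mem_union_right _ (Finset.mem_filter.2 ⟨Finset.mem_univ _, hqT, w, hwE, ?_⟩)
          rcases hpq with h | h <;> simp [h, hpS]
        refine ⟨{w}, by simpa using hwE, fun B hSB hBT => ?_⟩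
        have hpB := hSB hpS
        have hqB := Finset.disjoint_right.1 hBT hqT
        rw [Finset.filter_singleton, if_pos, Finset.card_singleton]
        rcases hpq with h | h <;> simp [EdgeCrosses, h, hpB, hqB]
      · have hp := (Finset.mem_filter.1 ((Finset.mem_union.1 hpA).resolve_left hpS)).2
        obtain ⟨hpT, e, heE, he⟩ := hp
        obtain ⟨s, hs, hes⟩ : ∃ s ∈ S, ends e = (s, p) ∨ ends e = (p, s) := by
          rcases he with ⟨h1, h2⟩ | ⟨h1, h2⟩
          · exact ⟨_, h1, Or.inl (by rw [← h2])⟩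
          · exact ⟨_, h1, Or.inr (by rw [← h2])⟩
        have hqT : q ∈ T := by
          have := hcross w hwE
          rcases hpq with h | h <;> simpa [EdgeCrosses, h, hpS, hqS, hpT] using this
        refine ⟨{e, w}, by simp [Finset.insert_subset_iff, heE, hwE], fun B hSB hBT => ?_⟩
        have hsB := hSB hs
        have hqB := Finset.disjoint_right.1 hBT hqT
        have hce : EdgeCrosses ends B e ↔ p ∉ B := by
          rcases hes with h | h <;> simp [EdgeCrosses, h, hsB]
        have hcw : EdgeCrosses ends B w ↔ p ∈ B := by
          rcases hpq with h | h <;> simp [EdgeCrosses, h, hqB]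
        by_cases hpB : p ∈ B <;> simp [Finset.filter_insert, Finset.filter_singleton, hce, hcw, hpB]
    have hDne : D.Nonempty := by
      obtain ⟨w, hw⟩ := Finset.card_pos.1 (by rw [hD S subset_rfl hST]; omega)
      exact ⟨w, (Finset.mem_filter.1 hw).1⟩
    obtain ⟨l, hl⟩ := ih (E \ D) S T F hST (by
        have h1 := Finset.card_sdiff_add_card_eq_card hDE
        have h2 := hDne.card_pos
        omega) (by
        intro A hSA hAT
        have h1 := hcut A hSA hAT
        have h2 := hD A hSA hAT
        have h3 : (E \ D).filter (EdgeCrosses ends A) =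
            E.filter (EdgeCrosses ends A) \ D.filter (EdgeCrosses ends A) := by
          ext w; simp only [Finset.mem_filter, Finset.mem_sdiff]; tauto
        rw [h3]
        have := Finset.le_card_sdiff (D.filter (EdgeCrosses ends A))
          (E.filter (EdgeCrosses ends A))
        omega)
    refine ⟨fun w => if w ∈ D then F else l w, fun i hi A hSA hAT => ?_⟩
    rcases Nat.lt_succ_iff_lt_or_eq.1 hi with hi | rfl
    · obtain ⟨w, hw, hwi, hc⟩ := hl i hi A hSA hAT
      obtain ⟨hwE, hwD⟩ := Finset.mem_sdiff.1 hw
      exact ⟨w, hwE, (if_neg hwD).trans hwi, hc⟩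
    · obtain ⟨w, hw⟩ := Finset.card_pos.1 (by rw [hD A hSA hAT]; omega)
      obtain ⟨hwD, hc⟩ := Finset.mem_filter.1 hw
      exact ⟨w, hDE hwD, if_pos hwD, hc⟩

namespace NetShape

theorem not_isSinkEdge_of_isSourceEdge (G : NetShape) {e : G.E} (h : G.IsSourceEdge e) :
    ¬ G.IsSinkEdge e := by
  have h1 := G.edge_internal e
  have h2 : (G.ends e).1 ∈ G.S → (G.ends e).1 ∉ G.T :=
    fun h => Finset.disjoint_left.1 G.ST_disjoint h
  have h3 : (G.ends e).2 ∈ G.S → (G.ends e).2 ∉ G.T :=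
    fun h => Finset.disjoint_left.1 G.ST_disjoint h
  unfold IsSourceEdge IsSinkEdge at *
  tauto

theorem contraction_eq_sum (G : NetShape) (d : G.E → ℕ) (𝒯 : G.TensorAssignment d)
    (b : (e : {e : G.E // G.IsSinkEdge e}) → Fin (d e.1))
    (a : (e : {e : G.E // G.IsSourceEdge e}) → Fin (d e.1)) :
    G.contraction d 𝒯 b a = ∑ g : (e : G.E) → Fin (d e),
      (if ∀ e : {e // G.IsSinkEdge e}, g e.1 = b e then 1 else 0) *
      (if ∀ e : {e // G.IsSourceEdge e}, g e.1 = a e then 1 else 0) *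
      ∏ u : {v : G.V // G.Internal v}, 𝒯 u fun e => g e.1 := by
  have hsum : ∀ f : ((e : G.E) → Fin (d e)) → ℂ, (∑ g : (e : G.E) → Fin (d e),
      (if ∀ e : {e // G.IsSinkEdge e}, g e.1 = b e then 1 else 0) *
      (if ∀ e : {e // G.IsSourceEdge e}, g e.1 = a e then 1 else 0) * f g) =
      ∑ g : (e : G.E) → Fin (d e) with
        (∀ e : {e // G.IsSinkEdge e}, g e.1 = b e) ∧
        (∀ e : {e // G.IsSourceEdge e}, g e.1 = a e), f g := by
    intro f
    rw [Finset.sum_filter]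
    refine Finset.sum_congr rfl fun g _ => ?_
    split_ifs <;> simp_all
  rw [hsum]
  refine Finset.sum_bij' (fun c _ => G.fullIndex d a b c) (fun g _ e => g e.1) ?_ ?_ ?_ ?_ ?_
  · intro c _
    refine Finset.mem_filter.2 ⟨Finset.mem_univ _, fun e => ?_, fun e => ?_⟩
    · have : ¬ G.IsSourceEdge e.1 := fun h => G.not_isSinkEdge_of_isSourceEdge h e.2
      simp [fullIndex, this, e.2]
    · simp [fullIndex, e.2]
  · intro g _
    exact Finset.mem_univ _
  · intro c _
    funext e
    simp [fullIndex, e.2.1, e.2.2]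
  · intro g hg
    obtain ⟨-, hb, ha⟩ := Finset.mem_filter.1 hg
    funext e
    unfold fullIndex
    split_ifs with h h'
    · exact (ha ⟨e, h⟩).symm
    · exact (hb ⟨e, h'⟩).symm
    · rfl
  · intro c _
    rfl

/-- A cut factors the contraction through the indices of the crossing edges. -/
theorem rank_contraction_le_cutValue (G : NetShape) (d : G.E → ℕ) (hd : ∀ e, 0 < d e)
    (𝒯 : G.TensorAssignment d) (A : Finset G.V) (hA : G.IsCut A) :
    (G.contraction d 𝒯).rank ≤ G.cutValue d A := by
  set L : ((e : G.E) → Fin (d e)) → ((e : {e : G.E // G.IsSourceEdge e}) → Fin (d e.1)) → ℂ :=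
    fun g a => (if ∀ e : {e // G.IsSourceEdge e}, g e.1 = a e then 1 else 0) *
      ∏ u : {v : G.V // G.Internal v}, if u.1 ∈ A then 𝒯 u (fun e => g e.1) else 1 with hL
  set M : ((e : G.E) → Fin (d e)) → ((e : {e : G.E // G.IsSinkEdge e}) → Fin (d e.1)) → ℂ :=
    fun g b => (if ∀ e : {e // G.IsSinkEdge e}, g e.1 = b e then 1 else 0) *
      ∏ u : {v : G.V // G.Internal v}, if u.1 ∈ A then 1 else 𝒯 u (fun e => g e.1) with hM
  have hLM : ∀ b a, G.contraction d 𝒯 b a = ∑ g, M g b * L g a := by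
    intro b a
    rw [contraction_eq_sum]
    refine Finset.sum_congr rfl fun g _ => ?_
    rw [hL, hM]
    dsimp only
    rw [mul_mul_mul_comm, ← Finset.prod_mul_distrib]
    congr 1
    refine Finset.prod_congr rfl fun u _ => ?_
    split_ifs <;> simp
  have hLc : ∀ g g' a, (∀ e, (G.ends e).1 ∈ A ∨ (G.ends e).2 ∈ A → g e = g' e) →
      L g a = L g' a := by
    intro g g' a h
    have h1 : ∀ e : {e // G.IsSourceEdge e}, g e.1 = g' e.1 := fun e =>
      h e.1 (e.2.imp (fun h => hA.1 h) (fun h => hA.1 h))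
    simp only [hL, h1]
    congr 1
    refine Finset.prod_congr rfl fun u _ => ?_
    split_ifs with hu
    · congr 1
      funext e
      exact h e.1 (e.2.imp (fun h' => by rwa [h']) (fun h' => by rwa [h']))
    · rfl
  have hMc : ∀ g g' b, (∀ e, (G.ends e).1 ∉ A ∨ (G.ends e).2 ∉ A → g e = g' e) →
      M g b = M g' b := by
    intro g g' b h
    have h1 : ∀ e : {e // G.IsSinkEdge e}, g e.1 = g' e.1 := fun e =>
      h e.1 (e.2.imp (hA.2 _) (hA.2 _))
    simp only [hM, h1]
    congr 1
    refine Finset.prod_congr rfl fun u _ => ?_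
    split_ifs with hu
    · rfl
    · congr 1
      funext e
      exact h e.1 (e.2.imp (fun h' => by rwa [h']) (fun h' => by rwa [h']))
  let g₀ : (e : G.E) → Fin (d e) := fun e => ⟨0, hd e⟩
  let ε := (Equiv.piEquivPiSubtypeProd (G.Crosses A) fun e => Fin (d e)).trans
    ((Equiv.refl _).prodCongr
      (Equiv.piEquivPiSubtypeProd (fun e : {e // ¬ G.Crosses A e} => (G.ends e.1).1 ∈ A)
        fun e => Fin (d e.1)))
  have hε : ∀ m p q e, ε.symm (m, p, q) e = if h : G.Crosses A e then m ⟨e, h⟩ else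
      if h' : (G.ends e).1 ∈ A then p ⟨⟨e, h⟩, h'⟩ else q ⟨⟨e, h⟩, h'⟩ := by
    intro m p q e
    rfl
  let B : Matrix ((e : {e : G.E // G.IsSinkEdge e}) → Fin (d e.1))
      ((e : {e : G.E // G.Crosses A e}) → Fin (d e.1)) ℂ :=
    fun b m => ∑ q, M (ε.symm (m, fun e => g₀ e.1.1, q)) b
  let C : Matrix ((e : {e : G.E // G.Crosses A e}) → Fin (d e.1))
      ((e : {e : G.E // G.IsSourceEdge e}) → Fin (d e.1)) ℂ :=
    fun m a => ∑ p, L (ε.symm (m, p, fun e => g₀ e.1.1)) a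
  have hBC : G.contraction d 𝒯 = B * C := by
    ext b a
    rw [hLM, Matrix.mul_apply, ← ε.symm.sum_comp, Fintype.sum_prod_type]
    refine Finset.sum_congr rfl fun m _ => ?_
    rw [Finset.sum_mul_sum, Fintype.sum_prod_type_right]
    refine Finset.sum_congr rfl fun q _ => Finset.sum_congr rfl fun p _ => ?_
    congr 1
    · apply hMc
      intro e he
      rw [hε, hε]
      split_ifs with h h'
      · rfl
      · exact absurd (Or.inl ⟨h', he.resolve_left (not_not.2 h')⟩) h
      · rfl
    · apply hLc
      intro e he
      rw [hε, hε]
      split_ifs with h h'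
      · rfl
      · rfl
      · exact absurd (Or.inr ⟨h', he.resolve_left h'⟩) h
  have hcard : Fintype.card ((e : {e : G.E // G.Crosses A e}) → Fin (d e.1)) =
      G.cutValue d A := by
    rw [Fintype.card_pi, cutValue]
    simp only [Fintype.card_fin]
    exact (Finset.prod_subtype _ (by simp) _).symm
  rw [hBC, ← hcard]
  exact (Matrix.rank_mul_le_left _ _).trans (Matrix.rank_le_card_width _)

theorem exists_cutValue_eq_MC (G : NetShape) (d : G.E → ℕ) :
    ∃ A, G.IsCut A ∧ G.cutValue d A = G.MC d :=
  Nat.sInf_mem (s := {w | ∃ A : Finset G.V, G.IsCut A ∧ G.cutValue d A = w})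
    ⟨_, G.S, ⟨subset_rfl, fun _ h => Finset.disjoint_right.1 G.ST_disjoint h⟩, rfl⟩

theorem MC_le_cutValue (G : NetShape) (d : G.E → ℕ) {A : Finset G.V} (hA : G.IsCut A) :
    G.MC d ≤ G.cutValue d A :=
  Nat.sInf_le ⟨A, hA, rfl⟩

theorem R1_le_cutValue (G : NetShape) (d : G.E → ℕ) (hd : ∀ e, 0 < d e)
    {A : Finset G.V} (hA : G.IsCut A) : G.R1 d ≤ G.cutValue d A := by
  apply csSup_le'
  rintro _ ⟨𝒯, rfl⟩
  exact G.rank_contraction_le_cutValue d hd 𝒯 A hA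

theorem rank_contraction_le_R1 (G : NetShape) (d : G.E → ℕ) (𝒯 : G.TensorAssignment d) :
    (G.contraction d 𝒯).rank ≤ G.R1 d := by
  refine le_csSup
    ⟨Fintype.card ((e : {e : G.E // G.IsSourceEdge e}) → Fin (d e.1)), ?_⟩ ⟨𝒯, rfl⟩
  rintro _ ⟨𝒯', rfl⟩
  exact Matrix.rank_le_card_width _

open Classical in
/-- If every edge carries `k e` bits and every cut is crossed by at least `F` of them, then `F` bits
can be transmitted. -/
theorem two_pow_le_R1 (G : NetShape) (d k : G.E → ℕ) (hk : ∀ e, 2 ^ k e ≤ d e) (F : ℕ)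
    (hF : ∀ A, G.IsCut A → F ≤ ∑ e with G.Crosses A e, k e) : 2 ^ F ≤ G.R1 d := by
  obtain ⟨l, hl⟩ := exists_labelling_of_le_cuts (W := Σ e : G.E, Fin (k e))
    (fun w => G.ends w.1) _ Finset.univ G.S G.T F G.ST_disjoint le_rfl (by
      intro A hSA hAT
      refine (hF A ⟨hSA, fun _ h => Finset.disjoint_right.1 hAT h⟩).trans (le_of_eq ?_)
      have : (Finset.univ.filter (EdgeCrosses (fun w : Σ e : G.E, Fin (k e) => G.ends w.1) A)) =
          (Finset.univ.filter (G.Crosses A)).sigma fun e => Finset.univ := by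
        ext w
        simp only [EdgeCrosses, Crosses, Finset.mem_filter, Finset.mem_sigma, Finset.mem_univ]
        tauto
      rw [this, Finset.card_sigma]
      simp)
  let φ : (Fin F → Bool) → (e : G.E) → Fin (d e) := fun x e =>
    ⟨Nat.ofBits fun t : Fin (k e) => if h : l ⟨e, t⟩ < F then x ⟨_, h⟩ else false,
      (Nat.ofBits_lt_two_pow _).trans_le (hk e)⟩
  have hφ : ∀ x e (t : Fin (k e)), (φ x e).1.testBit t =
      if h : l ⟨e, t⟩ < F then x ⟨_, h⟩ else false := fun x e t =>
    Nat.testBit_ofBits_lt _ _ t.2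
  let 𝒯 : G.TensorAssignment d := fun u g =>
    if ∀ e e' : {e // G.Incident u.1 e}, ∀ t : Fin (k e.1), ∀ t' : Fin (k e'.1),
      l ⟨e.1, t⟩ = l ⟨e'.1, t'⟩ → (g e).1.testBit t = (g e').1.testBit t' then 1 else 0
  let D : (Fin F → Bool) → (Fin F → Bool) → ℂ := fun y x =>
    G.contraction d 𝒯 (fun e => φ y e.1) (fun e => φ x e.1)
  have hdiag : ∀ x, D x x ≠ 0 := by
    intro x
    let w : ((e : {e : G.E // G.IsInternalEdge e}) → Fin (d e.1)) → ℕ := fun c =>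
      ∏ u : {v : G.V // G.Internal v}, if ∀ e e' : {e // G.Incident u.1 e},
        ∀ t : Fin (k e.1), ∀ t' : Fin (k e'.1), l ⟨e.1, t⟩ = l ⟨e'.1, t'⟩ →
          (G.fullIndex d (fun e => φ x e.1) (fun e => φ x e.1) c e.1).1.testBit t =
          (G.fullIndex d (fun e => φ x e.1) (fun e => φ x e.1) c e'.1).1.testBit t'
        then 1 else 0
    have hw : D x x = ((∑ c, w c : ℕ) : ℂ) := by
      simp [D, contraction, w, 𝒯]
    have hfull : G.fullIndex d (fun e => φ x e.1) (fun e => φ x e.1) (fun e => φ x e.1) = φ x := by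
      funext e
      unfold fullIndex
      split_ifs <;> rfl
    rw [hw, Nat.cast_ne_zero]
    intro h0
    have h1 := Finset.sum_eq_zero_iff.1 h0 (fun e => φ x e.1) (Finset.mem_univ _)
    obtain ⟨u, -, hu⟩ := Finset.prod_eq_zero_iff.1 h1
    rw [if_pos] at hu
    · exact one_ne_zero hu
    · intro e e' t t' h
      rw [hfull, hφ, hφ]
      simp only [h]
  have hoff : ∀ y x, y ≠ x → D y x = 0 := by
    intro y x hyx
    obtain ⟨i, hi⟩ := Function.ne_iff.1 hyx
    refine Finset.sum_eq_zero fun c _ => ?_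
    by_contra hne
    set g := G.fullIndex d (fun e => φ x e.1) (fun e => φ y e.1) c with hg
    have hloc : ∀ u, G.Internal u → ∀ e e', G.Incident u e → G.Incident u e' →
        ∀ (t : Fin (k e)) (t' : Fin (k e')), l ⟨e, t⟩ = l ⟨e', t'⟩ →
          (g e).1.testBit t = (g e').1.testBit t' := by
      intro u hu e e' he he' t t' h
      have h1 := Finset.prod_ne_zero_iff.1 hne ⟨u, hu⟩ (Finset.mem_univ _)
      by_contra h2
      exact h1 (if_neg fun h3 => h2 (h3 ⟨e, he⟩ ⟨e', he'⟩ t t' h))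
    have hsrc : ∀ e (t : Fin (k e)), G.IsSourceEdge e → l ⟨e, t⟩ = i →
        (g e).1.testBit t = x i := by
      intro e t he h
      have : g e = φ x e := by simp [hg, fullIndex, he]
      rw [this, hφ]
      simp [h]
    have hsnk : ∀ e (t : Fin (k e)), G.IsSinkEdge e → l ⟨e, t⟩ = i →
        (g e).1.testBit t = y i := by
      intro e t he h
      have hs : ¬ G.IsSourceEdge e := fun h => G.not_isSinkEdge_of_isSourceEdge h he
      have : g e = φ y e := by simp [hg, fullIndex, he, hs]
      rw [this, hφ]
      simp [h]
    let A : Finset G.V := G.S ∪ Finset.univ.filter fun v => G.Internal v ∧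
      ∃ e, ∃ t : Fin (k e), G.Incident v e ∧ l ⟨e, t⟩ = i ∧ (g e).1.testBit t = x i
    obtain ⟨⟨e, t⟩, -, hlw, hw⟩ := hl i i.2 A Finset.subset_union_left (by
      rw [Finset.disjoint_left]
      intro v hv hvT
      rcases Finset.mem_union.1 hv with h | h
      · exact Finset.disjoint_left.1 G.ST_disjoint h hvT
      · exact (Finset.mem_filter.1 h).2.1.2 hvT)
    obtain ⟨p, q, hpq, hpA, hqA⟩ : ∃ p q, (G.ends e = (p, q) ∨ G.ends e = (q, p)) ∧
        p ∈ A ∧ q ∉ A := by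
      by_cases h : (G.ends e).1 ∈ A
      · exact ⟨_, _, Or.inl rfl, h, fun h' => hw (by simp [h, h'])⟩
      · exact ⟨_, _, Or.inr rfl, by_contra fun h' => hw (by simp [h, h']), h⟩
    have hp : G.Incident p e := by rcases hpq with h | h <;> simp [Incident, h]
    have hq : G.Incident q e := by rcases hpq with h | h <;> simp [Incident, h]
    have hbit : (g e).1.testBit t = x i := by
      rcases Finset.mem_union.1 hpA with h | h
      · refine hsrc e t ?_ hlw
        rcases hpq with h' | h' <;> simp [IsSourceEdge, h', h]
      · obtain ⟨-, hpI, e', t', he', hlw', hb⟩ := Finset.mem_filter.1 h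
        rw [hloc p hpI e e' hp he' t t' (hlw.trans hlw'.symm), hb]
    have hqS : q ∉ G.S := fun h => hqA (Finset.mem_union_left _ h)
    by_cases hqT : q ∈ G.T
    · have := hsnk e t (by rcases hpq with h' | h' <;> simp [IsSinkEdge, h', hqT]) hlw
      exact hi (this.symm.trans hbit)
    · exact hqA (Finset.mem_union_right _
        (Finset.mem_filter.2 ⟨Finset.mem_univ _, ⟨hqS, hqT⟩, e, t, hq, hlw, hbit⟩))
  have hsub : (G.contraction d 𝒯).submatrix (fun y e => φ y e.1) (fun x e => φ x e.1) =
      Matrix.diagonal fun x => D x x := by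
    ext y x
    by_cases h : y = x
    · subst h
      simp [D]
    · rw [Matrix.diagonal_apply_ne _ h]
      exact hoff y x h
  have hrank : (Matrix.diagonal fun x => D x x).rank = 2 ^ F := by
    rw [Matrix.rank_diagonal, Fintype.card_subtype]
    simp [hdiag]
  rw [← hrank, ← hsub]
  exact (Matrix.rank_submatrix_le _ _ _).trans (G.rank_contraction_le_R1 d 𝒯)

theorem R1_pow_le (G : NetShape) (d : G.E → ℕ) (hd : ∀ e, 0 < d e) (n : ℕ) :
    G.R1 (fun e => d e ^ n) ≤ G.MC d ^ n := by
  obtain ⟨A, hA, hMC⟩ := G.exists_cutValue_eq_MC d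
  refine (G.R1_le_cutValue _ (fun e => pow_pos (hd e) n) hA).trans_eq ?_
  rw [← hMC, cutValue, cutValue, Finset.prod_pow]

theorem MC_pow_le (G : NetShape) (d : G.E → ℕ) (hd : ∀ e, 0 < d e) (n : ℕ) :
    G.MC d ^ n ≤ G.R1 (fun e => d e ^ n) * 2 ^ Fintype.card G.E := by
  let k : G.E → ℕ := fun e => Nat.log 2 (d e ^ n)
  obtain ⟨A, hA, hMC⟩ := G.exists_cutValue_eq_MC fun e => 2 ^ k e
  have hval : ∀ B, G.cutValue (fun e => 2 ^ k e) B = 2 ^ ∑ e with G.Crosses B e, k e :=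
    fun B => Finset.prod_pow_eq_pow_sum _ _ _
  have hle := G.two_pow_le_R1 (fun e => d e ^ n) k
    (fun e => Nat.pow_log_le_self 2 (pow_pos (hd e) n).ne')
    (∑ e with G.Crosses A e, k e) (by
      intro B hB
      have h := G.MC_le_cutValue (fun e => 2 ^ k e) hB
      rw [← hMC, hval, hval] at h
      exact (Nat.pow_le_pow_iff_right one_lt_two).1 h)
  calc G.MC d ^ n ≤ G.cutValue d A ^ n := Nat.pow_le_pow_left (G.MC_le_cutValue d hA) n
    _ = ∏ e with G.Crosses A e, d e ^ n := (Finset.prod_pow _ _ _).symm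
    _ ≤ ∏ e with G.Crosses A e, 2 ^ k e * 2 := Finset.prod_le_prod' fun e _ =>
        (Nat.lt_pow_succ_log_self one_lt_two _).le
    _ = 2 ^ (∑ e with G.Crosses A e, k e) * 2 ^ (Finset.univ.filter (G.Crosses A)).card := by
        rw [Finset.prod_mul_distrib, Finset.prod_const, Finset.prod_pow_eq_pow_sum]
    _ ≤ _ := Nat.mul_le_mul hle (Nat.pow_le_pow_right two_pos (Finset.card_le_univ _))

end NetShape

/-- the regularized tensor-network capacity equals the min-cut:
the sequence `n ↦ R1(N^⊠n)^(1/n)` converges to `MC(N)`. -/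
theorem stmt6 (G : NetShape) (d : G.E → ℕ) (hd : ∀ e, 2 ≤ d e) :
    Filter.Tendsto
      (fun n : ℕ => (G.R1 (fun e => d e ^ n) : ℝ) ^ ((n : ℝ)⁻¹))
      Filter.atTop (nhds (G.MC d : ℝ)) := by
  have hpos : ∀ e, 0 < d e := fun e => two_pos.trans_le (hd e)
  set K : ℝ := 2 ^ Fintype.card G.E with hK
  have hKpos : 0 < K := by positivity
  have hlim : Filter.Tendsto (fun n : ℕ => (G.MC d : ℝ) * K⁻¹ ^ ((n : ℝ)⁻¹))
      Filter.atTop (nhds (G.MC d : ℝ)) := by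
    have h := Filter.Tendsto.rpow (tendsto_const_nhds (x := K⁻¹))
      (tendsto_inv_atTop_nhds_zero_nat (𝕜 := ℝ)) (Or.inl (inv_pos.2 hKpos).ne')
    simpa using h.const_mul (G.MC d : ℝ)
  refine tendsto_of_tendsto_of_tendsto_of_le_of_le' hlim tendsto_const_nhds ?_ ?_
  · filter_upwards [Filter.eventually_ne_atTop 0] with n hn
    have h : (G.MC d : ℝ) ^ n ≤ G.R1 (fun e => d e ^ n) * K := by
      rw [hK]
      exact_mod_cast G.MC_pow_le d hpos n
    calc (G.MC d : ℝ) * K⁻¹ ^ ((n : ℝ)⁻¹)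
        = ((G.MC d : ℝ) ^ n * K⁻¹) ^ ((n : ℝ)⁻¹) := by
          rw [Real.mul_rpow (by positivity) (by positivity),
            Real.pow_rpow_inv_natCast (by positivity) hn]
      _ ≤ _ := Real.rpow_le_rpow (by positivity)
          (by rwa [← div_eq_mul_inv, div_le_iff₀ hKpos]) (by positivity)
  · filter_upwards [Filter.eventually_ne_atTop 0] with n hn
    calc (G.R1 (fun e => d e ^ n) : ℝ) ^ ((n : ℝ)⁻¹) ≤ ((G.MC d : ℝ) ^ n) ^ ((n : ℝ)⁻¹) :=
          Real.rpow_le_rpow (by positivity) (by exact_mod_cast G.R1_pow_le d hpos n)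
            (by positivity)
      _ = _ := Real.pow_rpow_inv_natCast (by positivity) hn
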